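/- For every n ≥ 1 and every T ≥ 2^n, there is no winning play of the pebble game of length T that uses at most n pebbles. (Equivalently: with n pebbles the player cannot pebble node 2^n and subsequently remove all pebbles from the board.) -/

import Mathlib

/-- A single legal move of the pebble game on nodes `1,…,T`: a pebble is put on or
removed from a node `i ∈ {1,…,T}`, subject to the rule that if `i > 1` then node
`i - 1` must carry a pebble at the time. -/
def PebbleStep (T : ℕ) (Q R : Finset ℕ) : Prop :=
  ∃ i : ℕ, 1 ≤ i ∧ i ≤ T ∧ (1 < i → i - 1 ∈ Q) ∧
    ((i ∉ Q ∧ R = insert i Q) ∨ (i ∈ Q ∧ R = Q.erase i))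

/-- A play of the pebble game of length `T`: a finite sequence of positions
`P_0, P_1, …, P_L` starting from the empty position `P_0 = ∅`, each next position
obtained from the previous one by a legal move. -/
def IsPlay (T : ℕ) (P : List (Finset ℕ)) : Prop :=
  P.head? = some ∅ ∧ List.Chain' (PebbleStep T) P

/-- The play uses at most `n` pebbles: every position has at most `n` pebbles on the board. -/
def UsesAtMost (n : ℕ) (P : List (Finset ℕ)) : Prop :=
  ∀ Q ∈ P, Q.card ≤ n

/-- The play is winning: node `T` is pebbled at some time and the final position is empty. -/
def IsWinning (T : ℕ) (P : List (Finset ℕ)) : Prop :=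
  (∃ Q ∈ P, T ∈ Q) ∧ P.getLast? = some ∅

/-- A legal move between two positions that both carry at most `n` pebbles. -/
def BoundedPebbleStep (T n : ℕ) (Q R : Finset ℕ) : Prop :=
  PebbleStep T Q R ∧ Q.card ≤ n ∧ R.card ≤ n

/-- The pebbles on nodes at most `m`. -/
def lowPart (m : ℕ) (Q : Finset ℕ) : Finset ℕ := Q.filter (· ≤ m)

/-- The pebbles on nodes beyond `m`, with node `m + j` renamed to `j`. -/
def highPart (m : ℕ) (Q : Finset ℕ) : Finset ℕ := (Q.filter (m < ·)).image (· - m)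

theorem mem_lowPart {m j : ℕ} {Q : Finset ℕ} : j ∈ lowPart m Q ↔ j ∈ Q ∧ j ≤ m := by
  simp [lowPart]

theorem mem_highPart {m j : ℕ} {Q : Finset ℕ} : j ∈ highPart m Q ↔ 1 ≤ j ∧ j + m ∈ Q := by
  simp only [highPart, Finset.mem_image, Finset.mem_filter]
  constructor
  · rintro ⟨a, ⟨ha, hm⟩, rfl⟩
    exact ⟨by omega, by rwa [Nat.sub_add_cancel hm.le]⟩
  · rintro ⟨hj, h⟩
    exact ⟨j + m, ⟨h, by omega⟩, by omega⟩

theorem card_lowPart_add_card_highPart_le (m : ℕ) (Q : Finset ℕ) :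
    (lowPart m Q).card + (highPart m Q).card ≤ Q.card := by
  have h := Finset.card_filter_add_card_filter_not (s := Q) (· ≤ m)
  simp only [not_le] at h
  have h' : (highPart m Q).card ≤ _ := Finset.card_image_le
  simp only [lowPart]
  omega

theorem PebbleStep.symm {T : ℕ} {Q R : Finset ℕ} (h : PebbleStep T Q R) : PebbleStep T R Q := by
  obtain ⟨i, h1, hT, hi, ⟨hQ, rfl⟩ | ⟨hQ, rfl⟩⟩ := h
  · exact ⟨i, h1, hT, fun h => Finset.mem_insert_of_mem (hi h),
      .inr ⟨Finset.mem_insert_self _ _, (Finset.erase_insert hQ).symm⟩⟩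
  · exact ⟨i, h1, hT, fun h => Finset.mem_erase.2 ⟨by omega, hi h⟩,
      .inl ⟨Finset.notMem_erase _ _, (Finset.insert_erase hQ).symm⟩⟩

theorem BoundedPebbleStep.symm {T n : ℕ} {Q R : Finset ℕ} (h : BoundedPebbleStep T n Q R) :
    BoundedPebbleStep T n R Q :=
  ⟨h.1.symm, h.2.2, h.2.1⟩

theorem PebbleStep.lowPart {T : ℕ} {Q R : Finset ℕ} (h : PebbleStep T Q R) (m : ℕ) :
    lowPart m R = lowPart m Q ∨ PebbleStep T (lowPart m Q) (lowPart m R) := by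
  obtain ⟨i, h1, hT, hi, h⟩ := h
  by_cases him : i ≤ m
  · refine .inr ⟨i, h1, hT, fun h => mem_lowPart.2 ⟨hi h, by omega⟩, ?_⟩
    rcases h with ⟨hQ, rfl⟩ | ⟨hQ, rfl⟩
    · refine .inl ⟨by simp [mem_lowPart, hQ], ?_⟩
      ext j
      simp only [mem_lowPart, Finset.mem_insert]
      grind
    · refine .inr ⟨by simp [mem_lowPart, hQ, him], ?_⟩
      ext j
      simp only [mem_lowPart, Finset.mem_erase]
      grind
  · left
    ext j
    rcases h with ⟨hQ, rfl⟩ | ⟨hQ, rfl⟩ <;>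
      simp only [mem_lowPart, Finset.mem_erase, Finset.mem_insert] <;> grind

theorem PebbleStep.highPart {T : ℕ} {Q R : Finset ℕ} (h : PebbleStep T Q R) (m : ℕ) :
    highPart m R = highPart m Q ∨ PebbleStep T (highPart m Q) (highPart m R) := by
  obtain ⟨i, h1, hT, hi, h⟩ := h
  by_cases him : i ≤ m
  · left
    ext j
    rcases h with ⟨hQ, rfl⟩ | ⟨hQ, rfl⟩ <;>
      simp only [mem_highPart, Finset.mem_erase, Finset.mem_insert] <;> grind
  · obtain ⟨k, rfl⟩ : ∃ k, i = k + m := ⟨i - m, by omega⟩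
    refine .inr ⟨k, by omega, by omega, fun h => mem_highPart.2 ⟨by omega, ?_⟩, ?_⟩
    · rw [← Nat.sub_add_comm h.le]
      exact hi (by omega)
    rcases h with ⟨hQ, rfl⟩ | ⟨hQ, rfl⟩
    · refine .inl ⟨by simp [mem_highPart, hQ], ?_⟩
      ext j
      simp only [mem_highPart, Finset.mem_insert]
      grind
    · refine .inr ⟨mem_highPart.2 ⟨by omega, hQ⟩, ?_⟩
      ext j
      simp only [mem_highPart, Finset.mem_erase]
      grind

/-- The first pebble beyond node `m` can only be placed while node `m` is pebbled. -/
theorem PebbleStep.mem_of_highPart_eq_empty {T m : ℕ} {Q R : Finset ℕ} (h : PebbleStep T Q R)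
    (hm : 1 ≤ m) (hQ : _root_.highPart m Q = ∅) (hR : (_root_.highPart m R).Nonempty) :
    m ∈ Q ∧ _root_.lowPart m R = _root_.lowPart m Q := by
  obtain ⟨j, hj⟩ := hR
  rw [mem_highPart] at hj
  have hQ' : ∀ k, 1 ≤ k → k + m ∉ Q := fun k hk hkQ => by
    have := mem_highPart.2 ⟨hk, hkQ⟩
    simp [hQ] at this
  obtain ⟨i, h1, hT, hi, ⟨hiQ, rfl⟩ | ⟨hiQ, rfl⟩⟩ := h
  · have hij : i = j + m := by
      have := hQ' j hj.1
      grind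
    subst hij
    have hmem := hi (by omega)
    have hj1 : j = 1 := by
      by_contra hne
      exact hQ' (j - 1) (by omega) (by rwa [← Nat.sub_add_comm hj.1])
    subst hj1
    refine ⟨by simpa using hmem, ?_⟩
    ext k
    simp only [mem_lowPart, Finset.mem_insert]
    grind
  · exact absurd (Finset.mem_of_mem_erase hj.2) (hQ' j hj.1)

open Relation in
theorem notMem_of_reflTransGen_boundedPebbleStep {T n k : ℕ} {Q : Finset ℕ} (hk : 2 ^ n ≤ k)
    (h : ReflTransGen (BoundedPebbleStep T n) ∅ Q) : k ∉ Q := by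
  induction n generalizing k Q with
  | zero =>
    rcases ReflTransGen.cases_tail h with rfl | ⟨_, _, hstep⟩
    · simp
    · simp [Finset.card_eq_zero.1 (Nat.le_zero.1 hstep.2.2)]
  | succ n ih =>
    set m := 2 ^ n with hm
    have hm1 : 1 ≤ m := Nat.one_le_two_pow
    have lowPart_nonempty : ∀ {S R : Finset ℕ}, m ∈ S →
        ReflTransGen (BoundedPebbleStep T n) S R → R.Nonempty := by
      intro S R hS hSR
      by_contra hR
      rw [Finset.not_nonempty_iff_eq_empty] at hR
      subst hR
      exact ih le_rfl (ReflTransGen.mono (fun _ _ => BoundedPebbleStep.symm) _ _ hSR.swap) hS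
    have invariant : highPart m Q = ∅ ∨
        (∃ S, m ∈ S ∧ ReflTransGen (BoundedPebbleStep T n) S (lowPart m Q)) ∧
          ReflTransGen (BoundedPebbleStep T n) ∅ (highPart m Q) := by
      clear hk
      induction h with
      | refl => left; simp [highPart]
      | @tail Q R _ hstep hQ =>
        obtain ⟨hstep, hcQ, hcR⟩ := hstep
        rcases (highPart m R).eq_empty_or_nonempty with hR | hR
        · exact .inl hR
        right
        have hsQ := card_lowPart_add_card_highPart_le m Q
        have hsR := card_lowPart_add_card_highPart_le m R
        have extend_high (hQR : (lowPart m Q).Nonempty) (hRR : (lowPart m R).Nonempty)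
            (hr : ReflTransGen (BoundedPebbleStep T n) ∅ (highPart m Q)) :
            ReflTransGen (BoundedPebbleStep T n) ∅ (highPart m R) := by
          have := hQR.card_pos
          have := hRR.card_pos
          rcases hstep.highPart m with heq | hs
          · rwa [heq]
          · exact hr.tail ⟨hs, by omega, by omega⟩
        rcases (highPart m Q).eq_empty_or_nonempty with hQe | hQne
        · obtain ⟨hmQ, hlow⟩ := hstep.mem_of_highPart_eq_empty hm1 hQe hR
          have hmem : m ∈ lowPart m Q := mem_lowPart.2 ⟨hmQ, le_rfl⟩
          exact ⟨⟨lowPart m R, hlow ▸ hmem, .refl⟩,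
            extend_high ⟨m, hmem⟩ ⟨m, hlow ▸ hmem⟩ (hQe ▸ .refl)⟩
        · obtain ⟨⟨S, hS, hSQ⟩, hhigh⟩ := hQ.resolve_left hQne.ne_empty
          have hSR : ReflTransGen (BoundedPebbleStep T n) S (lowPart m R) := by
            have := hQne.card_pos
            have := hR.card_pos
            rcases hstep.lowPart m with heq | hs
            · rwa [heq]
            · exact hSQ.tail ⟨hs, by omega, by omega⟩
          exact ⟨⟨S, hS, hSR⟩,
            extend_high (lowPart_nonempty hS hSQ) (lowPart_nonempty hS hSR) hhigh⟩
    have hkm : m + m ≤ k := by rw [pow_succ] at hk; omega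
    intro hkQ
    have hmem : k - m ∈ highPart m Q :=
      mem_highPart.2 ⟨by omega, by rwa [Nat.sub_add_cancel (by omega)]⟩
    rcases invariant with hempty | ⟨-, hhigh⟩
    · simp [hempty] at hmem
    · exact ih (by omega) hhigh hmem

open Relation in
theorem reflTransGen_boundedPebbleStep_of_isChain {T n : ℕ} {Q R : Finset ℕ}
    {P : List (Finset ℕ)} (hP : List.IsChain (PebbleStep T) (Q :: P))
    (hn : UsesAtMost n (Q :: P)) (hR : R ∈ Q :: P) :
    ReflTransGen (BoundedPebbleStep T n) Q R := by
  induction P generalizing Q with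
  | nil => rw [List.mem_singleton.1 hR]
  | cons S P ih =>
    rcases List.mem_cons.1 hR with rfl | hR
    · exact .refl
    · rw [List.isChain_cons_cons] at hP
      exact .head ⟨hP.1, hn _ (by simp), hn _ (by simp)⟩
        (ih hP.2 (fun U hU => hn U (List.mem_cons_of_mem _ hU)) hR)

/-- For every `n ≥ 1` and every `T ≥ 2^n`, there is no winning play of the pebble game
of length `T` that uses at most `n` pebbles. -/
theorem no_winning_play_of_two_pow_le (n T : ℕ) (hn : 1 ≤ n) (hT : 2 ^ n ≤ T) :
    ¬ ∃ P : List (Finset ℕ), IsPlay T P ∧ UsesAtMost n P ∧ IsWinning T P := by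
  rintro ⟨P, ⟨hhead, hchain⟩, hcard, ⟨Q, hQ, hTQ⟩, -⟩
  obtain ⟨P', rfl⟩ := List.head?_eq_some_iff.1 hhead
  exact notMem_of_reflTransGen_boundedPebbleStep hT
    (reflTransGen_boundedPebbleStep_of_isChain hchain hcard hQ) hTQ
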